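/- Let λ : ℕ → ℝ be a sequence with λ(n) → ∞ as n → ∞ and t : ℕ → ℝ a sequence with t(n) ≥ 1 for all n. For i = 1, 2 let A_i > 0, α_i > 0 and define ρ_i(n) = A_i·exp(−λ(n)/(2α_i²)). Then the series Σ_n t(n)·((ρ₂(n) − ρ₁(n))/ρ₁(n))² converges if and only if A₁ = A₂ and α₁ = α₂. -/

import Mathlib

/-- The squared exponential (RBF) spectral density `ρ(n) = A·exp(−λ(n)/(2α²))` on a
compact Riemannian manifold with Laplace–Beltrami eigenvalues `λ(n)`. -/
noncomputable def rbfSpec (A α : ℝ) (lam : ℕ → ℝ) (n : ℕ) : ℝ :=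
  A * Real.exp (-lam n / (2 * α ^ 2))

open Filter Topology

theorem rbfSpec_pos {A : ℝ} (hA : 0 < A) (α : ℝ) (lam : ℕ → ℝ) (n : ℕ) :
    0 < rbfSpec A α lam n :=
  mul_pos hA (Real.exp_pos _)

theorem rbfSpec_div_rbfSpec (A₁ A₂ α₁ α₂ : ℝ) (lam : ℕ → ℝ) (n : ℕ) :
    rbfSpec A₂ α₂ lam n / rbfSpec A₁ α₁ lam n =
      A₂ / A₁ * Real.exp ((1 / (2 * α₁ ^ 2) - 1 / (2 * α₂ ^ 2)) * lam n) := by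
  rw [rbfSpec, rbfSpec, mul_div_mul_comm, ← Real.exp_sub]
  congr 2
  ring

/-- If `f` tends to infinity and `K * exp (c * f)` tends to `1`, then `K = 1` and `c = 0`. -/
theorem eq_one_and_eq_zero_of_tendsto_mul_exp {ι : Type*} {l : Filter ι} [l.NeBot]
    {f : ι → ℝ} (hf : Tendsto f l atTop) {K c : ℝ} (hK : 0 < K)
    (h : Tendsto (fun i => K * Real.exp (c * f i)) l (𝓝 1)) : K = 1 ∧ c = 0 := by
  rcases lt_trichotomy c 0 with hc | rfl | hc
  · have h0 : Tendsto (fun i => K * Real.exp (c * f i)) l (𝓝 (K * 0)) :=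
      (Real.tendsto_exp_atBot.comp (hf.const_mul_atTop_of_neg hc)).const_mul K
    simpa using tendsto_nhds_unique h h0
  · simp only [zero_mul, Real.exp_zero, mul_one] at h
    exact ⟨tendsto_nhds_unique tendsto_const_nhds h, rfl⟩
  · have htop : Tendsto (fun i => K * Real.exp (c * f i)) l atTop :=
      (Real.tendsto_exp_atTop.comp (hf.const_mul_atTop hc)).const_mul_atTop hK
    exact absurd h (not_tendsto_nhds_of_tendsto_atTop htop 1)

/-- If the weights `t` are at least `1` and `∑ t n * x n ^ 2` converges, then `x` tends to `0`. -/
theorem tendsto_zero_of_summable_mul_sq {t x : ℕ → ℝ} (ht : ∀ n, 1 ≤ t n)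
    (h : Summable fun n => t n * x n ^ 2) : Tendsto x atTop (𝓝 0) := by
  have hsq : Tendsto (fun n => x n ^ 2) atTop (𝓝 0) :=
    squeeze_zero (fun n => sq_nonneg _)
      (fun n => le_mul_of_one_le_left (sq_nonneg _) (ht n)) h.tendsto_atTop_zero
  rw [tendsto_zero_iff_abs_tendsto_zero]
  simpa [Function.comp_def, Real.sqrt_sq_eq_abs] using hsq.sqrt

/-- Let `λ : ℕ → ℝ` be a sequence with `λ(n) → ∞` as `n → ∞` and
`t : ℕ → ℝ` a sequence with `t(n) ≥ 1` for all `n`. For `i = 1,2` let `A_i > 0`,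
`α_i > 0` and define `ρ_i(n) = A_i·exp(−λ(n)/(2α_i²))`. Then the series
`Σ_n t(n)·((ρ₂(n) − ρ₁(n))/ρ₁(n))²` converges if and only if `A₁ = A₂` and `α₁ = α₂`. -/
theorem stmt_7 (lam t : ℕ → ℝ)
    (hlim : Filter.Tendsto lam Filter.atTop Filter.atTop)
    (ht : ∀ n, 1 ≤ t n)
    (A₁ A₂ α₁ α₂ : ℝ) (hA₁ : 0 < A₁) (hA₂ : 0 < A₂) (hα₁ : 0 < α₁) (hα₂ : 0 < α₂) :
    (Summable fun n : ℕ => t n *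
        ((rbfSpec A₂ α₂ lam n - rbfSpec A₁ α₁ lam n) / rbfSpec A₁ α₁ lam n) ^ 2) ↔
      (A₁ = A₂ ∧ α₁ = α₂) := by
  constructor
  · intro h
    have hratio : Tendsto (fun n => A₂ / A₁ *
        Real.exp ((1 / (2 * α₁ ^ 2) - 1 / (2 * α₂ ^ 2)) * lam n)) atTop (𝓝 1) := by
      have h1 := (tendsto_zero_of_summable_mul_sq ht h).add_const 1
      rw [zero_add] at h1
      refine h1.congr fun n => ?_
      rw [← rbfSpec_div_rbfSpec, sub_div, div_self (rbfSpec_pos hA₁ α₁ lam n).ne',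
        sub_add_cancel]
    obtain ⟨hK, hc⟩ := eq_one_and_eq_zero_of_tendsto_mul_exp hlim (div_pos hA₂ hA₁) hratio
    refine ⟨((div_eq_one_iff_eq hA₁.ne').mp hK).symm, ?_⟩
    rw [sub_eq_zero, one_div, one_div, inv_inj] at hc
    exact (pow_left_inj₀ hα₁.le hα₂.le two_ne_zero).mp (mul_left_cancel₀ two_ne_zero hc)
  · rintro ⟨rfl, rfl⟩
    simp
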